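/- arXiv:2411.04626 — 2 statements merged into one kernel-verified Lean document; each statement's English description precedes it below -/
import Mathlib

section
/- Let A0, A1, A2 ∈ M₂(ℂ) be trace-free matrices with A0 + A1 + A2 = 0, and let a0, a1, a2 ∈ ℂ with det A_k = a_k² for each k (so the eigenvalues of A_k are ±i·a_k). Then: (i) the triple {A0, A1, A2} is reducible if and only if a0 + ε1·a1 + ε2·a2 = 0 for some choice of signs ε1, ε2 ∈ {1, −1}; (ii) the triple {A0, A1, A2} is irreducible and unitarizable if and only if det A_k is a nonnegative real number for each k and the nonnegative square roots â_k := √(det A_k) satisfy the strict Euclidean triangle inequalities: â0 < â1 + â2, â1 < â0 + â2, and â2 < â0 + â1. -/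
open Matrix

/-- 2×2 complex matrices. -/
abbrev M2 : Type := Matrix (Fin 2) (Fin 2) ℂ

/-- A triple of 2×2 matrices is reducible if they have a common eigenvector. -/
def ReducibleTriple (A0 A1 A2 : M2) : Prop :=
  ∃ w : Fin 2 → ℂ, w ≠ 0 ∧
    (∃ μ : ℂ, A0.mulVec w = μ • w) ∧
    (∃ μ : ℂ, A1.mulVec w = μ • w) ∧
    (∃ μ : ℂ, A2.mulVec w = μ • w)

/-- A triple of 2×2 matrices is unitarizable (into `su₂`) if some `C ∈ SL₂ℂ`
simultaneously conjugates all of them into skew-Hermitian matrices. -/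
def UnitarizableLieTriple (A0 A1 A2 : M2) : Prop :=
  ∃ C : M2, C.det = 1 ∧
    (C * A0 * C⁻¹)ᴴ = -(C * A0 * C⁻¹) ∧
    (C * A1 * C⁻¹)ᴴ = -(C * A1 * C⁻¹) ∧
    (C * A2 * C⁻¹)ᴴ = -(C * A2 * C⁻¹)

/-- The polynomial `x² + y² + z² - 2xy - 2yz - 2zx`; minus its value at the squares of the side
lengths of a triangle is sixteen times the squared area. -/
def heronForm {R : Type*} [CommRing R] (x y z : R) : R :=
  x ^ 2 + y ^ 2 + z ^ 2 - 2 * x * y - 2 * y * z - 2 * z * x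

theorem heronForm_sq {R : Type*} [CommRing R] (a b c : R) :
    heronForm (a ^ 2) (b ^ 2) (c ^ 2) =
      (a + b + c) * (a + b - c) * (a - b + c) * (a - b - c) := by
  unfold heronForm
  ring

theorem heronForm_sq_eq_zero_iff {R : Type*} [CommRing R] [IsDomain R] (a b c : R) :
    heronForm (a ^ 2) (b ^ 2) (c ^ 2) = 0 ↔
      ∃ ε₁ ε₂ : R, (ε₁ = 1 ∨ ε₁ = -1) ∧ (ε₂ = 1 ∨ ε₂ = -1) ∧ a + ε₁ * b + ε₂ * c = 0 := by
  rw [heronForm_sq]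
  constructor
  · intro h
    simp only [mul_eq_zero] at h
    rcases h with ((h | h) | h) | h
    · exact ⟨1, 1, by simp, by simp, by linear_combination h⟩
    · exact ⟨1, -1, by simp, by simp, by linear_combination h⟩
    · exact ⟨-1, 1, by simp, by simp, by linear_combination h⟩
    · exact ⟨-1, -1, by simp, by simp, by linear_combination h⟩
  · rintro ⟨ε₁, ε₂, rfl | rfl, rfl | rfl, h⟩
    · linear_combination (a + b - c) * (a - b + c) * (a - b - c) * h
    · linear_combination (a + b + c) * (a - b + c) * (a - b - c) * h
    · linear_combination (a + b + c) * (a + b - c) * (a - b - c) * h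
    · linear_combination (a + b + c) * (a + b - c) * (a - b + c) * h

theorem heronForm_sq_neg_iff {a b c : ℝ} (ha : 0 ≤ a) (hb : 0 ≤ b) (hc : 0 ≤ c) :
    heronForm (a ^ 2) (b ^ 2) (c ^ 2) < 0 ↔ a < b + c ∧ b < a + c ∧ c < a + b := by
  rw [heronForm_sq]
  constructor
  · intro h
    refine ⟨?_, ?_, ?_⟩ <;> by_contra! hle <;> refine absurd h (not_lt.mpr ?_)
    · have h1 : 0 ≤ a + b + c := by linarith
      have h2 : 0 ≤ a + b - c := by linarith
      have h3 : 0 ≤ a - b + c := by linarith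
      have h4 : 0 ≤ a - b - c := by linarith
      positivity
    · have h1 : 0 ≤ a + b + c := by linarith
      have h2 : 0 ≤ a + b - c := by linarith
      exact mul_nonneg_of_nonpos_of_nonpos
        (mul_nonpos_of_nonneg_of_nonpos (by positivity) (by linarith)) (by linarith)
    · have h1 : 0 ≤ a + b + c := by linarith
      have h3 : 0 ≤ a - b + c := by linarith
      exact mul_nonneg_of_nonpos_of_nonpos
        (mul_nonpos_of_nonpos_of_nonneg
          (mul_nonpos_of_nonneg_of_nonpos h1 (by linarith)) h3) (by linarith)
  · rintro ⟨h1, h2, h3⟩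
    have p1 : 0 < a + b + c := by linarith
    have p2 : 0 < a + b - c := by linarith
    have p3 : 0 < a - b + c := by linarith
    exact mul_neg_of_pos_of_neg (by positivity) (by linarith)

theorem mulVec_eq_smul_iff {R : Type*} [CommRing R] {A : Matrix (Fin 2) (Fin 2) R}
    {w : Fin 2 → R} {μ : R} :
    A.mulVec w = μ • w ↔
      A 0 0 * w 0 + A 0 1 * w 1 = μ * w 0 ∧ A 1 0 * w 0 + A 1 1 * w 1 = μ * w 1 := by
  simp [funext_iff, Fin.forall_fin_two]

theorem apply_one_one_eq_neg {R : Type*} [CommRing R] {A : Matrix (Fin 2) (Fin 2) R}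
    (hA : A.trace = 0) : A 1 1 = -A 0 0 := by
  rw [trace_fin_two] at hA
  linear_combination hA

theorem exists_mulVec_eq_smul_of_sq {A : M2} (hA : A.trace = 0) {μ : ℂ} (hμ : μ ^ 2 = -A.det) :
    ∃ w : Fin 2 → ℂ, w ≠ 0 ∧ A.mulVec w = μ • w := by
  have h : (A - μ • (1 : M2)).det = 0 := by
    rw [det_fin_two] at hμ ⊢
    rw [trace_fin_two] at hA
    simp
    linear_combination hμ - μ * hA
  obtain ⟨w, hw, hw0⟩ := exists_mulVec_eq_zero_iff.mpr h
  refine ⟨w, hw, ?_⟩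
  rw [sub_mulVec, smul_mulVec, one_mulVec, sub_eq_zero] at hw0
  exact hw0

theorem exists_mulVec_eq_smul {A : M2} (hA : A.trace = 0) :
    ∃ (w : Fin 2 → ℂ) (μ : ℂ), w ≠ 0 ∧ A.mulVec w = μ • w := by
  obtain ⟨μ, hμ⟩ := IsAlgClosed.exists_pow_nat_eq (-A.det) (n := 2) (by norm_num)
  obtain ⟨w, hw, h⟩ := exists_mulVec_eq_smul_of_sq hA hμ
  exact ⟨w, μ, hw, h⟩

theorem sq_eq_neg_det_of_mulVec_eq_smul {A : M2} (hA : A.trace = 0) {w : Fin 2 → ℂ} (hw : w ≠ 0)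
    {μ : ℂ} (h : A.mulVec w = μ • w) : μ ^ 2 = -A.det := by
  have hdet : (A - μ • (1 : M2)).det = 0 :=
    exists_mulVec_eq_zero_iff.mp ⟨w, hw, by rw [sub_mulVec, smul_mulVec, one_mulVec, h, sub_self]⟩
  rw [det_fin_two] at hdet ⊢
  rw [trace_fin_two] at hA
  simp at hdet
  linear_combination hdet + μ * hA

/-- Trace-free commuting `2 × 2` matrices are linearly dependent. -/
theorem exists_eq_smul_of_commute {A B : M2} (hA : A.trace = 0) (hB : B.trace = 0)
    (hA0 : A ≠ 0) (h : Commute A B) : ∃ c : ℂ, B = c • A := by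
  have hA1 := apply_one_one_eq_neg hA
  have hB1 := apply_one_one_eq_neg hB
  have h00 := congrFun (congrFun h.eq 0) 0
  have h01 := congrFun (congrFun h.eq 0) 1
  have h10 := congrFun (congrFun h.eq 1) 0
  simp only [mul_apply, Fin.sum_univ_two, hA1, hB1] at h00 h01 h10
  by_cases h1 : A 0 0 = 0
  · by_cases h2 : A 0 1 = 0
    · have h3 : A 1 0 ≠ 0 := by
        intro h3
        apply hA0
        ext i j
        fin_cases i <;> fin_cases j <;> simp [h1, h2, h3, hA1]
      refine ⟨B 1 0 / A 1 0, ?_⟩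
      ext i j
      fin_cases i <;> fin_cases j <;> simp [hA1, hB1] <;> field_simp <;> grind
    · refine ⟨B 0 1 / A 0 1, ?_⟩
      ext i j
      fin_cases i <;> fin_cases j <;> simp [hA1, hB1] <;> field_simp <;> grind
  · refine ⟨B 0 0 / A 0 0, ?_⟩
    ext i j
    fin_cases i <;> fin_cases j <;> simp [hA1, hB1] <;> field_simp <;> grind

theorem exists_eigenvector_pair_of_commute {A B : M2} (hA : A.trace = 0) (hB : B.trace = 0)
    (h : Commute A B) :
    ∃ w : Fin 2 → ℂ, w ≠ 0 ∧ (∃ μ : ℂ, A.mulVec w = μ • w) ∧ ∃ μ : ℂ, B.mulVec w = μ • w := by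
  by_cases hA0 : A = 0
  · obtain ⟨w, μ, hw, hμ⟩ := exists_mulVec_eq_smul hB
    exact ⟨w, hw, ⟨0, by simp [hA0]⟩, μ, hμ⟩
  · obtain ⟨c, rfl⟩ := exists_eq_smul_of_commute hA hB hA0 h
    obtain ⟨w, μ, hw, hμ⟩ := exists_mulVec_eq_smul hA
    exact ⟨w, hw, ⟨μ, hμ⟩, c * μ, by rw [smul_mulVec, hμ, smul_smul]⟩

/-- The kernel of a nonzero `2 × 2` matrix is at most one-dimensional. -/
theorem exists_eq_smul_of_mulVec_eq_zero {B : M2} (hB : B ≠ 0) {w x : Fin 2 → ℂ} (hw : w ≠ 0)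
    (hBw : B.mulVec w = 0) (hBx : B.mulVec x = 0) : ∃ c : ℂ, x = c • w := by
  have hdet : w 0 * x 1 = w 1 * x 0 := by
    by_contra hne
    apply hB
    simp [funext_iff, Fin.forall_fin_two] at hBw hBx
    ext i j
    have hne' := sub_ne_zero.mpr hne
    apply mul_left_cancel₀ hne'
    fin_cases i <;> fin_cases j <;> simp <;> grind
  by_cases h0 : w 0 = 0
  · have h1 : w 1 ≠ 0 := by
      intro h1
      apply hw
      ext i
      fin_cases i <;> simp [h0, h1]
    refine ⟨x 1 / w 1, ?_⟩
    ext i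
    fin_cases i <;> simp <;> field_simp; grind
  · refine ⟨x 0 / w 0, ?_⟩
    ext i
    fin_cases i <;> simp <;> field_simp; grind

theorem mul_self_eq_neg_det_smul_one {A : M2} (hA : A.trace = 0) : A * A = -A.det • (1 : M2) := by
  have hA1 := apply_one_one_eq_neg hA
  ext i j
  fin_cases i <;> fin_cases j <;> simp [mul_apply, Fin.sum_univ_two, det_fin_two, hA1] <;> ring

theorem exists_eigenvector_pair_of_det_commutator {A B : M2} (hA : A.trace = 0)
    (hB : B.trace = 0) (h : (A * B - B * A).det = 0) :
    ∃ w : Fin 2 → ℂ, w ≠ 0 ∧ (∃ μ : ℂ, A.mulVec w = μ • w) ∧ ∃ μ : ℂ, B.mulVec w = μ • w := by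
  by_cases h0 : A * B - B * A = 0
  · exact exists_eigenvector_pair_of_commute hA hB (sub_eq_zero.mp h0)
  obtain ⟨w, hw, hw0⟩ := exists_mulVec_eq_zero_iff.mpr h
  have hAK : (A * B - B * A) * A = -(A * (A * B - B * A)) := by
    have e : (A * B - B * A) * A + A * (A * B - B * A) = A * A * B - B * (A * A) := by
      noncomm_ring
    rw [mul_self_eq_neg_det_smul_one hA] at e
    exact eq_neg_of_add_eq_zero_left (by simpa using e)
  have hBK : (A * B - B * A) * B = -(B * (A * B - B * A)) := by
    have e : (A * B - B * A) * B + B * (A * B - B * A) = A * (B * B) - B * B * A := by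
      noncomm_ring
    rw [mul_self_eq_neg_det_smul_one hB] at e
    exact eq_neg_of_add_eq_zero_left (by simpa using e)
  refine ⟨w, hw, exists_eq_smul_of_mulVec_eq_zero h0 hw hw0 ?_,
    exists_eq_smul_of_mulVec_eq_zero h0 hw hw0 ?_⟩
  · rw [mulVec_mulVec, hAK, neg_mulVec, ← mulVec_mulVec, hw0, mulVec_zero, neg_zero]
  · rw [mulVec_mulVec, hBK, neg_mulVec, ← mulVec_mulVec, hw0, mulVec_zero, neg_zero]

theorem det_commutator_eq_heronForm {A B : M2} (hA : A.trace = 0) (hB : B.trace = 0) :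
    (A * B - B * A).det = -heronForm A.det B.det (-(A + B)).det := by
  have hA1 := apply_one_one_eq_neg hA
  have hB1 := apply_one_one_eq_neg hB
  simp [det_fin_two, mul_apply, Fin.sum_univ_two, hA1, hB1, heronForm]
  ring

theorem reducibleTriple_iff_heronForm {A0 A1 A2 : M2}
    (htr0 : A0.trace = 0) (htr1 : A1.trace = 0) (htr2 : A2.trace = 0)
    (hsum : A0 + A1 + A2 = 0) :
    ReducibleTriple A0 A1 A2 ↔ heronForm A0.det A1.det A2.det = 0 := by
  have hA2 : A2 = -(A0 + A1) := eq_neg_of_add_eq_zero_right hsum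
  constructor
  · rintro ⟨w, hw, ⟨μ0, h0⟩, ⟨μ1, h1⟩, μ2, h2⟩
    have hμ : μ0 + μ1 + μ2 = 0 := by
      have e : (μ0 + μ1 + μ2) • w = 0 := by
        rw [add_smul, add_smul, ← h0, ← h1, ← h2, ← add_mulVec, ← add_mulVec, hsum, zero_mulVec]
      exact (smul_eq_zero.mp e).resolve_right hw
    have e0 := sq_eq_neg_det_of_mulVec_eq_smul htr0 hw h0
    have e1 := sq_eq_neg_det_of_mulVec_eq_smul htr1 hw h1
    have e2 := sq_eq_neg_det_of_mulVec_eq_smul htr2 hw h2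
    have e : heronForm A0.det A1.det A2.det = heronForm (μ0 ^ 2) (μ1 ^ 2) (μ2 ^ 2) := by
      rw [e0, e1, e2]
      unfold heronForm
      ring
    rw [e, heronForm_sq, hμ]
    ring
  · intro h
    obtain ⟨w, hw, ⟨μ0, h0⟩, μ1, h1⟩ := exists_eigenvector_pair_of_det_commutator htr0 htr1
      (by rw [det_commutator_eq_heronForm htr0 htr1, ← hA2, h, neg_zero])
    exact ⟨w, hw, ⟨μ0, h0⟩, ⟨μ1, h1⟩, -(μ0 + μ1), by
      rw [hA2, neg_mulVec, add_mulVec, h0, h1, neg_smul, add_smul]⟩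

theorem exists_real_of_conjTranspose_eq_neg {X : M2} (hX : Xᴴ = -X) (htr : X.trace = 0) :
    ∃ x y z : ℝ,
      X = !![Complex.I * x, y + Complex.I * z; -y + Complex.I * z, -(Complex.I * x)] := by
  have h1 := apply_one_one_eq_neg htr
  have h00 := congrFun (congrFun hX 0) 0
  have h01 := congrFun (congrFun hX 1) 0
  simp [conjTranspose_apply, Complex.ext_iff] at h00 h01
  refine ⟨(X 0 0).im, (X 0 1).re, (X 0 1).im, ?_⟩
  ext i j
  fin_cases i <;> fin_cases j <;> simp [Complex.ext_iff, h1] <;> grind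

theorem exists_det_eq_of_skewHermitian {X0 X1 X2 : M2} (h0 : X0ᴴ = -X0) (h1 : X1ᴴ = -X1)
    (htr0 : X0.trace = 0) (htr1 : X1.trace = 0) (hsum : X0 + X1 + X2 = 0) :
    ∃ d0 d1 d2 : ℝ, 0 ≤ d0 ∧ 0 ≤ d1 ∧ 0 ≤ d2 ∧
      X0.det = d0 ∧ X1.det = d1 ∧ X2.det = d2 ∧ heronForm d0 d1 d2 ≤ 0 := by
  have hX2 : X2 = -(X0 + X1) := eq_neg_of_add_eq_zero_right hsum
  obtain ⟨x, y, z, rfl⟩ := exists_real_of_conjTranspose_eq_neg h0 htr0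
  obtain ⟨u, v, w, rfl⟩ := exists_real_of_conjTranspose_eq_neg h1 htr1
  refine ⟨x ^ 2 + y ^ 2 + z ^ 2, u ^ 2 + v ^ 2 + w ^ 2, (x + u) ^ 2 + (y + v) ^ 2 + (z + w) ^ 2,
    by positivity, by positivity, by positivity, ?_, ?_, ?_, ?_⟩
  · simp [det_fin_two]
    linear_combination (-(x : ℂ) ^ 2 - z ^ 2) * Complex.I_sq
  · simp [det_fin_two]
    linear_combination (-(u : ℂ) ^ 2 - w ^ 2) * Complex.I_sq
  · rw [hX2]
    simp [det_fin_two]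
    linear_combination (-((x : ℂ) + u) ^ 2 - (z + w) ^ 2) * Complex.I_sq
  · unfold heronForm
    nlinarith [sq_nonneg (x * v - y * u), sq_nonneg (y * w - z * v), sq_nonneg (z * u - x * w)]

/-- Any invertible complex matrix can be rescaled to have determinant one, which does not change
conjugation by it. -/
theorem exists_det_eq_one_conj {S : M2} (hS : S.det ≠ 0) :
    ∃ C : M2, C.det = 1 ∧ ∀ A X : M2, A * S = S * X → C * A * C⁻¹ = X := by
  obtain ⟨k, hk⟩ := IsAlgClosed.exists_pow_nat_eq S.det (n := 2) (by norm_num)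
  have hk0 : k ≠ 0 := by
    rintro rfl
    exact hS (by rw [← hk]; norm_num)
  have hSu : IsUnit S.det := isUnit_iff_ne_zero.mpr hS
  have hinv : (k • S⁻¹)⁻¹ = k⁻¹ • S := by
    apply inv_eq_right_inv
    rw [smul_mul_smul_comm, mul_inv_cancel₀ hk0, one_smul, nonsing_inv_mul S hSu]
  refine ⟨k • S⁻¹, ?_, fun A X h => ?_⟩
  · rw [det_smul, det_nonsing_inv, Ring.inverse_eq_inv', Fintype.card_fin, hk, mul_inv_cancel₀ hS]
  · rw [hinv, smul_mul_assoc, smul_mul_smul_comm, mul_inv_cancel₀ hk0, one_smul, mul_assoc, h,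
      ← mul_assoc, nonsing_inv_mul S hSu, one_mul]

/-- Normal form of an irreducible pair: an eigenbasis of `A` in which `B` is skew-Hermitian as
soon as `b`, `y` and `m` are real. -/
theorem exists_normal_form {A B : M2} (hA : A.trace = 0) (hB : B.trace = 0) {b y m : ℂ}
    (hb : b ≠ 0) (hm : m ≠ 0) (hdA : A.det = b ^ 2) (hdB : B.det = y ^ 2 + m ^ 2)
    (hAB : (-(A + B)).det = b ^ 2 + (y ^ 2 + m ^ 2) + 2 * b * y) :
    ∃ S : M2, S.det ≠ 0 ∧
      A * S = S * !![Complex.I * b, 0; 0, -(Complex.I * b)] ∧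
      B * S = S * !![Complex.I * y, -m; m, -(Complex.I * y)] := by
  have hI := Complex.I_sq
  obtain ⟨v, hv, hAv⟩ := exists_mulVec_eq_smul_of_sq hA (μ := Complex.I * b)
    (by rw [hdA]; linear_combination b ^ 2 * hI)
  have hA1 := apply_one_one_eq_neg hA
  have hB1 := apply_one_one_eq_neg hB
  rw [mulVec_eq_smul_iff] at hAv
  obtain ⟨hv0, hv1⟩ := hAv
  simp [det_fin_two, hA1, hB1] at hdA hdB hAB hv0 hv1
  set p := A 0 0
  set q := A 0 1
  set r := A 1 0
  set s := B 0 0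
  set t := B 0 1
  set l := B 1 0
  have hc : 2 * p * s + q * l + r * t = -2 * b * y := by linear_combination hdA + hdB - hAB
  obtain ⟨u0, hu0⟩ : ∃ u0, m * u0 = s * v 0 + t * v 1 - Complex.I * y * v 0 :=
    ⟨_, mul_div_cancel₀ _ hm⟩
  obtain ⟨u1, hu1⟩ : ∃ u1, m * u1 = l * v 0 - s * v 1 - Complex.I * y * v 1 :=
    ⟨_, mul_div_cancel₀ _ hm⟩
  have hAu0 : p * u0 + q * u1 = -(Complex.I * b) * u0 := by
    apply mul_left_cancel₀ hm
    linear_combination p * hu0 + q * hu1 + Complex.I * b * hu0 + hc * v 0 - (s +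
      Complex.I * y) * hv0 - t * hv1 + (-2) * b * y * v 0 * hI
  have hAu1 : r * u0 - p * u1 = -(Complex.I * b) * u1 := by
    apply mul_left_cancel₀ hm
    linear_combination r * hu0 - p * hu1 + Complex.I * b * hu1 + hc * v 1 - l * hv0 +
      (s - Complex.I * y) * hv1 + (-2) * b * y * v 1 * hI
  have hBu0 : s * u0 + t * u1 = -m * v 0 - Complex.I * y * u0 := by
    apply mul_left_cancel₀ hm
    linear_combination s * hu0 + t * hu1 + Complex.I * y * hu0 - v 0 * hdB - y ^ 2 * v 0 * hI
  have hBu1 : l * u0 - s * u1 = -m * v 1 - Complex.I * y * u1 := by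
    apply mul_left_cancel₀ hm
    linear_combination l * hu0 - s * hu1 + Complex.I * y * hu1 - v 1 * hdB - y ^ 2 * v 1 * hI
  refine ⟨!![v 0, u0; v 1, u1], ?_, ?_, ?_⟩
  · intro hdet
    simp [det_fin_two] at hdet
    have hIb : 2 * (Complex.I * b) ≠ 0 := by simp [hb]
    have k1 : v 0 * u0 = 0 := by
      apply mul_left_cancel₀ hIb
      linear_combination -u0 * hv0 + v 0 * hAu0 - q * hdet
    have k2 : v 1 * u1 = 0 := by
      apply mul_left_cancel₀ hIb
      linear_combination -u1 * hv1 + v 1 * hAu1 + r * hdet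
    have k3 : v 0 * u1 = 0 := by
      apply mul_left_cancel₀ hIb
      linear_combination -u1 * hv0 + v 1 * hAu0 + (p + Complex.I * b) * hdet
    have k4 : v 1 * u0 = 0 := by
      linear_combination k3 - hdet
    apply hv
    ext i
    fin_cases i <;> simp <;> grind
  · ext i j
    fin_cases i <;> fin_cases j <;>
      simp [mul_apply, Fin.sum_univ_two, hA1] <;> grind
  · ext i j
    fin_cases i <;> fin_cases j <;>
      simp [mul_apply, Fin.sum_univ_two, hB1] <;> grind

/-- let `A0, A1, A2 ∈ sl₂ℂ` with `A0 + A1 + A2 = 0` and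
`det A_k = a_k²` (so the eigenvalues of `A_k` are `±i·a_k`).  Then:
(i) `{A0,A1,A2}` is reducible iff `a0 ± a1 ± a2 = 0` for some signs;
(ii) `{A0,A1,A2}` is irreducible and unitarizable iff each `det A_k` is a
nonnegative real and the nonnegative square roots `â_k = √(det A_k)` satisfy the
strict Euclidean triangle inequalities. -/
theorem sl2_triple_reducible_and_unitarizable
    (A0 A1 A2 : M2)
    (htr0 : A0.trace = 0) (htr1 : A1.trace = 0) (htr2 : A2.trace = 0)
    (hsum : A0 + A1 + A2 = 0)
    (a0 a1 a2 : ℂ)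
    (hd0 : A0.det = a0 ^ 2) (hd1 : A1.det = a1 ^ 2) (hd2 : A2.det = a2 ^ 2) :
    (ReducibleTriple A0 A1 A2 ↔
      ∃ ε1 ε2 : ℂ, (ε1 = 1 ∨ ε1 = -1) ∧ (ε2 = 1 ∨ ε2 = -1) ∧
        a0 + ε1 * a1 + ε2 * a2 = 0) ∧
    ((¬ ReducibleTriple A0 A1 A2 ∧ UnitarizableLieTriple A0 A1 A2) ↔
      ∃ b0 b1 b2 : ℝ, 0 ≤ b0 ∧ 0 ≤ b1 ∧ 0 ≤ b2 ∧
        A0.det = (b0 : ℂ) ^ 2 ∧ A1.det = (b1 : ℂ) ^ 2 ∧ A2.det = (b2 : ℂ) ^ 2 ∧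
        b0 < b1 + b2 ∧ b1 < b0 + b2 ∧ b2 < b0 + b1) := by
  have hred := reducibleTriple_iff_heronForm htr0 htr1 htr2 hsum
  have hA2 : A2 = -(A0 + A1) := eq_neg_of_add_eq_zero_right hsum
  refine ⟨by rw [hred, hd0, hd1, hd2, heronForm_sq_eq_zero_iff], ?_, ?_⟩
  · rintro ⟨hirr, C, hC, h0, h1, -⟩
    have hCu : IsUnit C.det := by rw [hC]; exact isUnit_one
    have hCi : C⁻¹ * C = 1 := nonsing_inv_mul C hCu
    have htr : ∀ A : M2, (C * A * C⁻¹).trace = A.trace := fun A => by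
      rw [trace_mul_comm, ← mul_assoc, hCi, one_mul]
    have hdet : ∀ A : M2, (C * A * C⁻¹).det = A.det := fun A => by
      rw [det_mul, det_mul, det_nonsing_inv, hC]; simp
    obtain ⟨d0, d1, d2, hp0, hp1, hp2, e0, e1, e2, hle⟩ :=
      exists_det_eq_of_skewHermitian (X2 := C * A2 * C⁻¹) h0 h1 (by rw [htr, htr0])
        (by rw [htr, htr1]) (by rw [← add_mul, ← add_mul, ← mul_add, ← mul_add, hsum]; simp)
    rw [hdet] at e0 e1 e2
    have hne : heronForm d0 d1 d2 ≠ 0 := by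
      intro h
      apply hirr
      rw [hred, e0, e1, e2]
      unfold heronForm at h ⊢
      exact_mod_cast h
    have hlt := lt_of_le_of_ne hle hne
    rw [← Real.sq_sqrt hp0, ← Real.sq_sqrt hp1, ← Real.sq_sqrt hp2, heronForm_sq_neg_iff
      (Real.sqrt_nonneg _) (Real.sqrt_nonneg _) (Real.sqrt_nonneg _)] at hlt
    refine ⟨√d0, √d1, √d2, Real.sqrt_nonneg _, Real.sqrt_nonneg _, Real.sqrt_nonneg _,
      ?_, ?_, ?_, hlt⟩
    · rw [e0, ← Complex.ofReal_pow, Real.sq_sqrt hp0]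
    · rw [e1, ← Complex.ofReal_pow, Real.sq_sqrt hp1]
    · rw [e2, ← Complex.ofReal_pow, Real.sq_sqrt hp2]
  · rintro ⟨b0, b1, b2, hb0, hb1, hb2, e0, e1, e2, h⟩
    have hb0' : 0 < b0 := by linarith [h.2.1, h.2.2]
    have hlt := (heronForm_sq_neg_iff hb0 hb1 hb2).mpr h
    constructor
    · rw [hred, e0, e1, e2]
      intro h0
      apply hlt.ne
      unfold heronForm at h0 ⊢
      exact_mod_cast h0
    · obtain ⟨y, hy⟩ : ∃ y : ℝ, 2 * b0 * y = b2 ^ 2 - b0 ^ 2 - b1 ^ 2 :=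
        ⟨_, mul_div_cancel₀ _ (by positivity)⟩
      have hpos : 0 < b1 ^ 2 - y ^ 2 := by
        have e : 4 * b0 ^ 2 * (b1 ^ 2 - y ^ 2) = -heronForm (b0 ^ 2) (b1 ^ 2) (b2 ^ 2) := by
          unfold heronForm
          linear_combination (-(2 * b0 * y) - (b2 ^ 2 - b0 ^ 2 - b1 ^ 2)) * hy
        exact pos_of_mul_pos_right (by rw [e]; linarith) (by positivity)
      have hm := Real.sq_sqrt hpos.le
      have hm0 := (Real.sqrt_pos.mpr hpos).ne'
      set m := √(b1 ^ 2 - y ^ 2)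
      have hb1' : (b1 : ℂ) ^ 2 = y ^ 2 + m ^ 2 := by
        exact_mod_cast (by linarith : b1 ^ 2 = y ^ 2 + m ^ 2)
      have hb2' : (b2 : ℂ) ^ 2 = b0 ^ 2 + (y ^ 2 + m ^ 2) + 2 * b0 * y := by
        exact_mod_cast (by linarith : b2 ^ 2 = b0 ^ 2 + (y ^ 2 + m ^ 2) + 2 * b0 * y)
      obtain ⟨S, hS, hS0, hS1⟩ := exists_normal_form htr0 htr1 (b := b0) (y := y) (m := m)
        (by exact_mod_cast hb0'.ne') (by exact_mod_cast hm0) e0 (by rw [e1, hb1'])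
        (by rw [← hA2, e2, hb2'])
      obtain ⟨C, hC, hconj⟩ := exists_det_eq_one_conj hS
      have c0 := hconj _ _ hS0
      have c1 := hconj _ _ hS1
      have s0 : (C * A0 * C⁻¹)ᴴ = -(C * A0 * C⁻¹) := by
        rw [c0]
        ext i j
        fin_cases i <;> fin_cases j <;> simp [conjTranspose_apply]
      have s1 : (C * A1 * C⁻¹)ᴴ = -(C * A1 * C⁻¹) := by
        rw [c1]
        ext i j
        fin_cases i <;> fin_cases j <;> simp [conjTranspose_apply]
      refine ⟨C, hC, s0, s1, ?_⟩
      have e : C * A2 * C⁻¹ = -(C * A0 * C⁻¹ + C * A1 * C⁻¹) := by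
        rw [hA2]; noncomm_ring
      rw [e, conjTranspose_neg, conjTranspose_add, s0, s1, ← neg_add]
end

section
/- Let A1, A2 ∈ M₂(ℂ) be trace-free matrices and set A0 := −A1 − A2. Then the triple {A0, A1, A2} is reducible (i.e. there exists a nonzero w ∈ ℂ² that is an eigenvector of A0, A1 and A2) if and only if det(A1·A2 − A2·A1) = 0. -/
open Matrix

/-- A nonzero vector is an eigenvector of a trace-free `2 × 2` matrix as soon as the quadratic
form `w ↦ w ∧ A w` vanishes on it. -/
theorem exists_mulVec_eq_smul_of_form_eq_zero {a b c x y : ℂ} (hw : x ≠ 0 ∨ y ≠ 0)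
    (h : c * x ^ 2 - 2 * a * x * y - b * y ^ 2 = 0) :
    ∃ μ : ℂ, (!![a, b; c, -a] : M2) *ᵥ ![x, y] = μ • ![x, y] := by
  rcases hw with hx | hy
  · refine ⟨(a * x + b * y) / x, ?_⟩
    ext i
    fin_cases i
    · simp [Matrix.mulVec, dotProduct, Fin.sum_univ_two]
      field_simp
    · simp [Matrix.mulVec, dotProduct, Fin.sum_univ_two]
      field_simp
      linear_combination h
  · refine ⟨(c * x - a * y) / y, ?_⟩
    ext i
    fin_cases i
    · simp [Matrix.mulVec, dotProduct, Fin.sum_univ_two]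
      field_simp
      linear_combination -h
    · simp [Matrix.mulVec, dotProduct, Fin.sum_univ_two]
      field_simp
      ring

theorem exists_form_eq_zero (a b c : ℂ) :
    ∃ x y : ℂ, (x ≠ 0 ∨ y ≠ 0) ∧ c * x ^ 2 - 2 * a * x * y - b * y ^ 2 = 0 := by
  by_cases hb : b = 0
  · exact ⟨0, 1, by simp, by simp [hb]⟩
  · obtain ⟨s, hs⟩ := IsAlgClosed.exists_pow_nat_eq (a ^ 2 + b * c) (n := 2) (by norm_num)
    exact ⟨b, s - a, Or.inl hb, by linear_combination -b * hs⟩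

/-- The hypothesis `h` says that the commutator of the trace-free matrices `!![a, b; c, -a]` and
`!![d, e; f, -d]` has determinant zero. -/
theorem exists_common_form_eq_zero {a b c d e f : ℂ}
    (h : (b * f - c * e) ^ 2 + 4 * (a * e - b * d) * (c * d - a * f) = 0) :
    ∃ x y : ℂ, (x ≠ 0 ∨ y ≠ 0) ∧ c * x ^ 2 - 2 * a * x * y - b * y ^ 2 = 0 ∧
      f * x ^ 2 - 2 * d * x * y - e * y ^ 2 = 0 := by
  by_cases hq : a * e - b * d = 0
  · have hp : b * f - c * e = 0 := by
      simpa [hq] using h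
    by_cases hr : c * d - a * f = 0
    · by_cases ha : a = 0
      · by_cases hb : b = 0
        · by_cases hc : c = 0
          · obtain ⟨x, y, hw, hB⟩ := exists_form_eq_zero d e f
            exact ⟨x, y, hw, by simp [ha, hb, hc], hB⟩
          · obtain ⟨x, y, hw, hA⟩ := exists_form_eq_zero a b c
            refine ⟨x, y, hw, hA, mul_left_cancel₀ hc ?_⟩
            linear_combination f * hA - 2 * x * y * hr + y ^ 2 * hp
        · obtain ⟨x, y, hw, hA⟩ := exists_form_eq_zero a b c
          refine ⟨x, y, hw, hA, mul_left_cancel₀ hb ?_⟩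
          linear_combination e * hA + x ^ 2 * hp + 2 * x * y * hq
      · obtain ⟨x, y, hw, hA⟩ := exists_form_eq_zero a b c
        refine ⟨x, y, hw, hA, mul_left_cancel₀ ha ?_⟩
        linear_combination d * hA - x ^ 2 * hr - y ^ 2 * hq
    · refine ⟨0, 1, by simp, ?_, ?_⟩
      · refine mul_left_cancel₀ hr ?_
        linear_combination a * hp + c * hq
      · refine mul_left_cancel₀ hr ?_
        linear_combination d * hp + f * hq
  · refine ⟨2 * (a * e - b * d), -(b * f - c * e), Or.inl (by simpa using hq), ?_, ?_⟩
    · linear_combination -b * h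
    · linear_combination -e * h

theorem eq_of_trace_eq_zero {A : M2} (h : A.trace = 0) :
    A = !![A 0 0, A 0 1; A 1 0, -A 0 0] := by
  rw [Matrix.trace_fin_two] at h
  rw [← eq_neg_of_add_eq_zero_right h]
  exact Matrix.eta_fin_two A

/-- let `A1, A2 ∈ sl₂ℂ` and `A0 := −A1 − A2`.  The triple
`{A0, A1, A2}` is reducible if and only if the commutator `[A1, A2]` has
vanishing determinant. -/
theorem reducible_iff_det_commutator_zero
    (A1 A2 : M2)
    (htr1 : A1.trace = 0) (htr2 : A2.trace = 0) :
    ReducibleTriple (-A1 - A2) A1 A2 ↔ (A1 * A2 - A2 * A1).det = 0 := by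
  constructor
  · rintro ⟨w, hw, -, ⟨μ, h1⟩, ν, h2⟩
    refine Matrix.exists_mulVec_eq_zero_iff.mp ⟨w, hw, ?_⟩
    rw [Matrix.sub_mulVec, ← Matrix.mulVec_mulVec, ← Matrix.mulVec_mulVec, h1, h2,
      Matrix.mulVec_smul, Matrix.mulVec_smul, h1, h2, smul_comm, sub_self]
  · intro h
    rw [eq_of_trace_eq_zero htr1, eq_of_trace_eq_zero htr2] at h ⊢
    obtain ⟨x, y, hw, hA, hB⟩ := exists_common_form_eq_zero (a := A1 0 0) (b := A1 0 1)
      (c := A1 1 0) (d := A2 0 0) (e := A2 0 1) (f := A2 1 0) (by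
        simp [Matrix.det_fin_two] at h
        linear_combination -h)
    obtain ⟨μ, hμ⟩ := exists_mulVec_eq_smul_of_form_eq_zero hw hA
    obtain ⟨ν, hν⟩ := exists_mulVec_eq_smul_of_form_eq_zero hw hB
    refine ⟨![x, y], ?_, ⟨-μ - ν, ?_⟩, ⟨μ, hμ⟩, ν, hν⟩
    · intro h0
      have hx : x = 0 := congrFun h0 0
      have hy : y = 0 := congrFun h0 1
      exact hw.elim (· hx) (· hy)
    · rw [Matrix.sub_mulVec, Matrix.neg_mulVec, hμ, hν, sub_smul, neg_smul]
end
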